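/- Fix z_R > 0, λ_a > 0, a nonzero mode l_m ∈ ℤ, a wavelength λ_i > 0 and a fixed z > 0. Let l₁, l₂ ∈ ℤ with l₁ ≠ 0 and |l₁| > |l₂|. Then the map β ↦ a_i^{l₁,l₂}(β, z) = g(λ_i, l₁, β·r_max(λ_a, l_m, z), z) / g(λ_i, l₂, β·r_max(λ_a, l_m, z), z) is strictly increasing on (0, ∞). -/

import Mathlib

open scoped BigOperators

/-- Squared beam waist: `ω(λ)² = λ·z_R/π`. -/
noncomputable def waistSq (zR lam : ℝ) : ℝ := lam * zR / Real.pi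

/-- Squared beam spot at axial distance `z`: `ω(λ,z)² = ω(λ)²·(1 + z²/z_R²)`. -/
noncomputable def spotSq (zR lam z : ℝ) : ℝ := waistSq zR lam * (1 + z ^ 2 / zR ^ 2)

/-- Maximum-strength radius `r_max(λ,l,z) = √(|l|/2)·ω(λ,z)`. -/
noncomputable def rmax (zR lam : ℝ) (l : ℤ) (z : ℝ) : ℝ :=
  Real.sqrt ((l.natAbs : ℝ) / 2 * spotSq zR lam z)

/-- `d_m(λ,l,z) = √(r_max(λ,l,z)² + z²)`; in particular `d_m(λ,0,z) = z` for `z > 0`. -/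
noncomputable def dm (zR lam : ℝ) (l : ℤ) (z : ℝ) : ℝ :=
  Real.sqrt (rmax zR lam l z ^ 2 + z ^ 2)

/-- OAM link gain at radius `r` and axial distance `z` (Equation (2) of the paper). -/
noncomputable def gain (zR lam : ℝ) (l : ℤ) (r z : ℝ) : ℝ :=
  if l = 0 then
    lam ^ 2 / ((4 * Real.pi) ^ 2 * z ^ 2) * Real.exp (-2 * r ^ 2 / spotSq zR lam z)
  else
    lam ^ 2 / ((4 * Real.pi) ^ 2 * dm zR lam l z ^ 2) *
      (r / rmax zR lam l z) ^ (2 * l.natAbs) *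
      Real.exp (2 * (rmax zR lam l z ^ 2 - r ^ 2) / spotSq zR lam z)

theorem spotSq_pos_aux (zR lam z : ℝ) (hzR : 0 < zR) (hlam : 0 < lam) : 0 < spotSq zR lam z := by
  have := Real.pi_pos
  unfold spotSq waistSq
  positivity

theorem rmax_pos_aux (zR lam z : ℝ) (l : ℤ) (hzR : 0 < zR) (hlam : 0 < lam) (hl : l ≠ 0) :
    0 < rmax zR lam l z := by
  have h := spotSq_pos_aux zR lam z hzR hlam
  have h2 : (0 : ℝ) < (l.natAbs : ℝ) := by exact_mod_cast Int.natAbs_pos.mpr hl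
  unfold rmax
  positivity

theorem gain_form_aux (zR lam z : ℝ) (l : ℤ) (hzR : 0 < zR) (hlam : 0 < lam) (hz : 0 < z) :
    ∃ C : ℝ, 0 < C ∧ ∀ r : ℝ, gain zR lam l r z =
      C * r ^ (2 * l.natAbs) * Real.exp (-2 * r ^ 2 / spotSq zR lam z) := by
  have hpi := Real.pi_pos
  by_cases hl : l = 0
  · refine ⟨lam ^ 2 / ((4 * Real.pi) ^ 2 * z ^ 2), by positivity, fun r => ?_⟩
    simp [gain, hl]
  · have hR := rmax_pos_aux zR lam z l hzR hlam hl
    have hd : 0 < dm zR lam l z := by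
      unfold dm
      positivity
    refine ⟨lam ^ 2 / ((4 * Real.pi) ^ 2 * dm zR lam l z ^ 2) / rmax zR lam l z ^ (2 * l.natAbs) *
      Real.exp (2 * rmax zR lam l z ^ 2 / spotSq zR lam z), by positivity, fun r => ?_⟩
    have he : 2 * (rmax zR lam l z ^ 2 - r ^ 2) / spotSq zR lam z =
      2 * rmax zR lam l z ^ 2 / spotSq zR lam z + -2 * r ^ 2 / spotSq zR lam z := by ring
    rw [gain, if_neg hl, he, Real.exp_add, div_pow]
    ring

/-- The cross-mode gain ratio `a_i^{l₁,l₂}(β, z)` is strictly increasing in `β` on `(0, ∞)`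
when `|l₁| > |l₂|` (and `l₁ ≠ 0`). -/
theorem gain_ratio_cross_mode_strictMono
    (zR lamA : ℝ) (lm : ℤ) (hzR : 0 < zR) (hlamA : 0 < lamA) (hlm : lm ≠ 0)
    (lamI : ℝ) (hlamI : 0 < lamI) (z : ℝ) (hz : 0 < z)
    (l₁ l₂ : ℤ) (hl₁ : l₁ ≠ 0) (hll : l₂.natAbs < l₁.natAbs) :
    StrictMonoOn
      (fun β => gain zR lamI l₁ (β * rmax zR lamA lm z) z /
                gain zR lamI l₂ (β * rmax zR lamA lm z) z)
      (Set.Ioi (0 : ℝ)) := by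
  obtain ⟨C₁, hC₁, h₁⟩ := gain_form_aux zR lamI z l₁ hzR hlamI hz
  obtain ⟨C₂, hC₂, h₂⟩ := gain_form_aux zR lamI z l₂ hzR hlamI hz
  have hR := rmax_pos_aux zR lamA z lm hzR hlamA hlm
  obtain ⟨k, hk⟩ := Nat.exists_eq_add_of_lt hll
  have key : ∀ r : ℝ, 0 < r → gain zR lamI l₁ r z / gain zR lamI l₂ r z =
      C₁ / C₂ * r ^ (2 * (k + 1)) := by
    intro r hr
    have hE := Real.exp_pos (-2 * r ^ 2 / spotSq zR lamI z)
    have hp : r ^ (2 * l₁.natAbs) = r ^ (2 * l₂.natAbs) * r ^ (2 * (k + 1)) := by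
      rw [← pow_add, hk]
      congr 1
      ring
    rw [h₁, h₂, hp]
    have hq : 0 < r ^ (2 * l₂.natAbs) := by positivity
    generalize Real.exp (-2 * r ^ 2 / spotSq zR lamI z) = E at *
    generalize r ^ (2 * l₂.natAbs) = q at *
    field_simp
  intro a ha b hb hab
  have ha' : 0 < a := ha
  have hb' : 0 < b := hb
  show gain zR lamI l₁ (a * rmax zR lamA lm z) z / gain zR lamI l₂ (a * rmax zR lamA lm z) z <
    gain zR lamI l₁ (b * rmax zR lamA lm z) z / gain zR lamI l₂ (b * rmax zR lamA lm z) z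
  rw [key _ (mul_pos ha' hR), key _ (mul_pos hb' hR)]
  refine mul_lt_mul_of_pos_left ?_ (div_pos hC₁ hC₂)
  exact pow_lt_pow_left₀ (mul_lt_mul_of_pos_right hab hR) (mul_pos ha' hR).le (by omega)
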